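/- Let G be a locally compact Hausdorff topological group that is unimodular, with Haar measure μ_G, acting measurably on a measure space (M, μ) such that μ is G-invariant. Let F : M → ℂ be measurable and G-invariant (F(x • m) = F(m) for all x, m), and let χ₁, χ₂ : M → [0, ∞) be measurable functions satisfying ∫_G χᵢ(x • m) dμ_G(x) = 1 for all m ∈ M and i = 1, 2. Assume χ₁·F and χ₂·F are integrable on M, and the functions (x, m) ↦ χ₂(x • m)·χ₁(m)·F(m) and (x, m) ↦ χ₁(x • m)·χ₂(m)·F(m) are integrable on G × M. Then ∫_M χ₁ F dμ = ∫_M χ₂ F dμ. -/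

import Mathlib

open MeasureTheory

section Aux

open Measure Set Pointwise ENNReal

theorem aux_subgroup (G : Type*) [Group G] [TopologicalSpace G] [IsTopologicalGroup G]
    [LocallyCompactSpace G] : ∃ H : Subgroup G, IsOpen (H : Set G) ∧ IsSigmaCompact (H : Set G) := by
  obtain ⟨K, hK, hK1⟩ := exists_compact_mem_nhds (1 : G)
  set S : Set G := K ∪ K⁻¹ with hS
  have hSc : IsCompact S := hK.union hK.inv
  have hSi : S⁻¹ = S := by simp [hS, Set.union_comm]
  let H : Subgroup G :=
    { carrier := ⋃ n : ℕ, S ^ n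
      mul_mem' := by
        intro a b ha hb
        obtain ⟨n, hn⟩ := mem_iUnion.1 ha
        obtain ⟨k, hk⟩ := mem_iUnion.1 hb
        exact mem_iUnion.2 ⟨n + k, by rw [pow_add]; exact mul_mem_mul hn hk⟩
      one_mem' := mem_iUnion.2 ⟨0, by simp⟩
      inv_mem' := by
        intro a ha
        obtain ⟨n, hn⟩ := mem_iUnion.1 ha
        refine mem_iUnion.2 ⟨n, ?_⟩
        rw [← hSi, inv_pow]
        simpa using hn }
  refine ⟨H, ?_, ?_⟩
  · apply Subgroup.isOpen_of_mem_nhds (g := 1)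
    refine Filter.mem_of_superset hK1 (fun x hx => ?_)
    exact mem_iUnion.2 ⟨1, by simp [hS, hx]⟩
  · refine ⟨fun n => S ^ n, fun n => ?_, rfl⟩
    induction n with
    | zero => simp
    | succ n ih =>
      change IsCompact (S ^ (n + 1))
      rw [pow_succ]; exact ih.mul hSc

theorem aux_inv {G : Type*} [Group G] [TopologicalSpace G] [IsTopologicalGroup G]
    [LocallyCompactSpace G] [T2Space G] [MeasurableSpace G] [BorelSpace G]
    (μG : Measure G) [μG.IsHaarMeasure] [μG.IsMulRightInvariant] [SigmaCompactSpace G] :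
    μG.IsInvInvariant := by
  constructor
  have key : ∀ s : Set G, IsCompact (closure s) → μG.inv s = haarScalarFactor μG.inv μG • μG s :=
    fun s hs => measure_isMulInvariant_eq_smul_of_isCompact_closure _ _ hs
  have hc : haarScalarFactor μG.inv μG = 1 := by
    obtain ⟨K, hK, hK1⟩ := exists_compact_mem_nhds (1 : G)
    set S : Set G := K ∪ K⁻¹ with hS
    have hSc : IsCompact S := hK.union hK.inv
    have hSi : S⁻¹ = S := by simp [hS, Set.union_comm]
    have h := key S (by rwa [hSc.isClosed.closure_eq])
    rw [Measure.inv_apply, hSi] at h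
    have h0 : μG S ≠ 0 := (measure_pos_of_mem_nhds μG (Filter.mem_of_superset hK1 subset_union_left)).ne'
    have h1 : μG S ≠ ∞ := hSc.measure_lt_top.ne
    rw [ENNReal.smul_def, smul_eq_mul] at h
    have := (ENNReal.mul_left_inj h0 h1).1 ((one_mul (μG S)).trans h)
    exact_mod_cast this.symm
  ext s hs
  have hu : s = ⋃ n, s ∩ compactCovering G n := by
    rw [← inter_iUnion, iUnion_compactCovering, inter_univ]
  have hm : Monotone fun n => s ∩ compactCovering G n :=
    fun a b h => inter_subset_inter_right _ (compactCovering_subset G h)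
  rw [hu, hm.measure_iUnion, hm.measure_iUnion]
  congr 1; ext n
  rw [key, hc, one_smul]
  exact (isCompact_compactCovering G n).closure_of_subset inter_subset_right


theorem aux_sfinite {G : Type*} [TopologicalSpace G] [T2Space G] [MeasurableSpace G] [BorelSpace G]
    (μG : Measure G) [IsFiniteMeasureOnCompacts μG] {C : Set G} (hC : IsSigmaCompact C)
    (hCm : MeasurableSet C) : SigmaFinite (μG.restrict C) := by
  obtain ⟨K, hK, hKC⟩ := hC
  refine ⟨⟨⟨fun n => K n ∪ Cᶜ, fun _ => trivial, fun n => ?_, ?_⟩⟩⟩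
  · rw [Measure.restrict_apply ((hK n).measurableSet.union hCm.compl)]
    refine (measure_mono ?_).trans_lt (hK n).measure_lt_top
    rintro x ⟨hx | hx, hx'⟩
    · exact hx
    · exact absurd hx' hx
  · rw [← iUnion_union, hKC, union_compl_self]

/-- Either the group is sigma-compact, or every cutoff function vanishes almost everywhere. -/
theorem aux_dichotomy {G : Type*} [Group G] [TopologicalSpace G] [IsTopologicalGroup G]
    [LocallyCompactSpace G] [T2Space G] [MeasurableSpace G] [BorelSpace G]
    (μG : Measure G) [μG.IsHaarMeasure]
    {M : Type*} [MeasurableSpace M] [MulAction G M]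
    (μ : Measure M) [SFinite μ]
    (hact : Measurable (fun p : G × M => p.1 • p.2))
    (hμinv : ∀ x : G, Measure.map (fun m : M => x • m) μ = μ) :
    SigmaCompactSpace G ∨ ∀ χ : M → ℝ, Measurable χ → (∀ m, 0 ≤ χ m) →
      (∀ m : M, ∫ x : G, χ (x • m) ∂μG = 1) → ∀ᵐ m ∂μ, χ m = 0 := by
  obtain ⟨H, hHo, hHs⟩ := aux_subgroup G
  let C : G ⧸ H → Set G := fun q => (QuotientGroup.mk : G → G ⧸ H) ⁻¹' {q}
  have hCeq : ∀ g : G, C (g : G ⧸ H) = (fun x => g * x) '' (H : Set G) := by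
    intro g
    ext x
    simp only [C, mem_preimage, mem_singleton_iff, image_mul_left, SetLike.mem_coe]
    rw [eq_comm, QuotientGroup.eq]
  have hCs : ∀ q, IsSigmaCompact (C q) := by
    intro q
    induction q using QuotientGroup.induction_on with
    | H g => rw [hCeq]; exact hHs.image (continuous_const_mul g)
  have hCo : ∀ q, IsOpen (C q) := by
    intro q
    induction q using QuotientGroup.induction_on with
    | H g => rw [hCeq]; exact isOpenMap_mul_left g _ hHo
  have hCn : ∀ q, (C q).Nonempty := fun q => QuotientGroup.mk_surjective q
  have hCd : Pairwise (Function.onFun Disjoint C) := fun a b hab =>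
    Disjoint.preimage _ (by simpa using hab)
  by_cases hcount : Countable (G ⧸ H)
  · left
    rw [← isSigmaCompact_univ_iff]
    have : (univ : Set G) = ⋃ q, C q := by
      ext x; simp [C]
    rw [this]
    exact isSigmaCompact_iUnion _ hCs
  right
  intro χ hχ hχ0 hcut
  have hsm : ∀ m : M, Measurable fun x : G => x • m := fun m =>
    hact.comp (measurable_id.prodMk measurable_const)
  have hsx : ∀ x : G, Measurable fun m : M => x • m := fun x =>
    hact.comp (measurable_const.prodMk measurable_id)
  let ν := μ.toFinite
  let φ : G ⧸ H → ℝ≥0∞ := fun q =>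
    ∫⁻ m, ∫⁻ x in C q, ENNReal.ofReal (χ (x • m)) ∂μG ∂ν
  have hjoint : Measurable fun p : G × M => ENNReal.ofReal (χ (p.1 • p.2)) :=
    (hχ.comp hact).ennreal_ofReal
  have hone : ∀ m, ∫⁻ x, ENNReal.ofReal (χ (x • m)) ∂μG = 1 := by
    intro m
    have hi : Integrable (fun x : G => χ (x • m)) μG := by
      by_contra h
      have := hcut m
      rw [integral_undef h] at this
      exact zero_ne_one this
    rw [← ofReal_integral_eq_lintegral_ofReal hi (Filter.Eventually.of_forall fun x => hχ0 _),
      hcut m, ENNReal.ofReal_one]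
  have hsum : ∑' q, φ q ≤ ν univ := by
    rw [ENNReal.tsum_eq_iSup_sum]
    refine iSup_le fun s => ?_
    have hmeas : ∀ q, Measurable fun m => ∫⁻ x in C q, ENNReal.ofReal (χ (x • m)) ∂μG := by
      intro q
      have := aux_sfinite μG (hCs q) (hCo q).measurableSet
      exact hjoint.lintegral_prod_left'
    rw [← lintegral_finsetSum _ fun q _ => hmeas q]
    calc _ ≤ ∫⁻ m, 1 ∂ν := by
          refine lintegral_mono fun m => ?_
          rw [← lintegral_biUnion_finset (fun a _ b _ hab => hCd hab)
            (fun q _ => (hCo q).measurableSet), ← hone m]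
          exact setLIntegral_le_lintegral _ _
      _ = ν univ := by simp
  have hsupp : (Function.support φ).Countable :=
    Summable.countable_support_ennreal (ne_top_of_le_ne_top (measure_ne_top ν _) hsum)
  obtain ⟨q, hq⟩ : ∃ q, φ q = 0 := by
    by_contra! h
    have : Function.support φ = univ := eq_univ_of_forall h
    rw [this, countable_univ_iff] at hsupp
    exact hcount hsupp
  have := aux_sfinite μG (hCs q) (hCo q).measurableSet
  have hswap : ∫⁻ x in C q, ∫⁻ m, ENNReal.ofReal (χ (x • m)) ∂ν ∂μG = 0 := by
    rw [lintegral_lintegral_swap hjoint.aemeasurable]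
    exact hq
  rw [lintegral_eq_zero_iff hjoint.lintegral_prod_right'] at hswap
  have hne : μG.restrict (C q) ≠ 0 := by
    rw [Ne, Measure.restrict_eq_zero]
    exact ((hCo q).measure_pos μG (hCn q)).ne'
  have : (ae (μG.restrict (C q))).NeBot := ae_neBot.2 hne
  obtain ⟨x, hx⟩ := hswap.exists
  have hx' : ∫⁻ m, ENNReal.ofReal (χ (x • m)) ∂ν = 0 := hx
  have hmx : Measurable fun m : M => ENNReal.ofReal (χ (x • m)) :=
    (hχ.comp (hsx x)).ennreal_ofReal
  rw [lintegral_eq_zero_iff hmx] at hx'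
  have h2 : ∀ᵐ m ∂μ, χ (x • m) = 0 := by
    filter_upwards [(absolutelyContinuous_toFinite μ).ae_le hx'] with m hm
    exact le_antisymm (ENNReal.ofReal_eq_zero.1 hm) (hχ0 _)
  rw [← hμinv x]
  exact (ae_map_iff (hsx x).aemeasurable (hχ (measurableSet_singleton 0))).2 h2

end Aux

/-- Let `G` be a unimodular locally compact Hausdorff group with Haar
measure `μG`, acting measurably on a measure space `(M, μ)` with `μ` invariant. Let
`F : M → ℂ` be measurable and `G`-invariant, and `χ₁, χ₂ : M → [0, ∞)` measurable cutoff
functions (`∫_G χᵢ (x • m) dμG = 1` for all `m`). If `χ₁·F`, `χ₂·F` are integrable on `M`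
and the two associated functions on `G × M` are integrable, then
`∫_M χ₁ F dμ = ∫_M χ₂ F dμ`. -/
theorem integral_cutoff_mul_invariant_indep
    {G : Type*} [Group G] [TopologicalSpace G] [IsTopologicalGroup G]
    [LocallyCompactSpace G] [T2Space G] [MeasurableSpace G] [BorelSpace G]
    (μG : Measure G) [μG.IsHaarMeasure] [μG.IsMulRightInvariant]
    {M : Type*} [MeasurableSpace M] [MulAction G M]
    (μ : Measure M) [SFinite μ]
    (hact : Measurable (fun p : G × M => p.1 • p.2))
    (hμinv : ∀ x : G, Measure.map (fun m : M => x • m) μ = μ)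
    (F : M → ℂ) (hF : Measurable F)
    (hFinv : ∀ (x : G) (m : M), F (x • m) = F m)
    (χ₁ χ₂ : M → ℝ) (hχ₁meas : Measurable χ₁) (hχ₂meas : Measurable χ₂)
    (hχ₁nonneg : ∀ m, 0 ≤ χ₁ m) (hχ₂nonneg : ∀ m, 0 ≤ χ₂ m)
    (hχ₁cut : ∀ m : M, ∫ x : G, χ₁ (x • m) ∂μG = 1)
    (hχ₂cut : ∀ m : M, ∫ x : G, χ₂ (x • m) ∂μG = 1)
    (hint₁ : Integrable (fun m : M => (χ₁ m : ℂ) * F m) μ)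
    (hint₂ : Integrable (fun m : M => (χ₂ m : ℂ) * F m) μ)
    (hprod₁ : Integrable
      (fun p : G × M => (χ₂ (p.1 • p.2) : ℂ) * (χ₁ p.2 : ℂ) * F p.2) (μG.prod μ))
    (hprod₂ : Integrable
      (fun p : G × M => (χ₁ (p.1 • p.2) : ℂ) * (χ₂ p.2 : ℂ) * F p.2) (μG.prod μ)) :
    ∫ m : M, (χ₁ m : ℂ) * F m ∂μ = ∫ m : M, (χ₂ m : ℂ) * F m ∂μ := by
  have hsx : ∀ x : G, Measurable fun m : M => x • m := fun x =>
    hact.comp (measurable_const.prodMk measurable_id)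
  rcases aux_dichotomy μG μ hact hμinv with hG | hzero
  swap
  · have h1 := hzero χ₁ hχ₁meas hχ₁nonneg hχ₁cut
    have h2 := hzero χ₂ hχ₂meas hχ₂nonneg hχ₂cut
    apply integral_congr_ae
    filter_upwards [h1, h2] with m hm1 hm2
    rw [hm1, hm2]
  have := aux_inv μG
  have hfib : ∀ χ ψ : M → ℝ, (∀ m : M, ∫ x : G, χ (x • m) ∂μG = 1) → ∀ m,
      ∫ x : G, (χ (x • m) : ℂ) * (ψ m : ℂ) * F m ∂μG = (ψ m : ℂ) * F m := by
    intro χ ψ hcut m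
    simp_rw [mul_assoc]
    rw [integral_mul_const, integral_complex_ofReal, hcut m]
    simp
  calc ∫ m : M, (χ₁ m : ℂ) * F m ∂μ
      = ∫ m : M, ∫ x : G, (χ₂ (x • m) : ℂ) * (χ₁ m : ℂ) * F m ∂μG ∂μ := by
        simp_rw [hfib χ₂ χ₁ hχ₂cut]
    _ = ∫ x : G, ∫ m : M, (χ₂ (x • m) : ℂ) * (χ₁ m : ℂ) * F m ∂μ ∂μG :=
        (integral_integral_swap hprod₁).symm
    _ = ∫ x : G, ∫ m : M, (χ₁ (x⁻¹ • m) : ℂ) * (χ₂ m : ℂ) * F m ∂μ ∂μG := by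
        congr 1
        ext x
        have hm : Measurable fun m : M => (χ₁ (x⁻¹ • m) : ℂ) * (χ₂ m : ℂ) * F m :=
          ((Complex.measurable_ofReal.comp (hχ₁meas.comp (hsx x⁻¹))).mul
            (Complex.measurable_ofReal.comp hχ₂meas)).mul hF
        conv_rhs => rw [← hμinv x]
        rw [integral_map (hsx x).aemeasurable hm.aestronglyMeasurable]
        congr 1
        ext m
        rw [inv_smul_smul, hFinv]
        ring
    _ = ∫ x : G, ∫ m : M, (χ₁ (x • m) : ℂ) * (χ₂ m : ℂ) * F m ∂μ ∂μG :=
        integral_inv_eq_self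
          (fun x : G => ∫ m : M, (χ₁ (x • m) : ℂ) * (χ₂ m : ℂ) * F m ∂μ) μG
    _ = ∫ m : M, ∫ x : G, (χ₁ (x • m) : ℂ) * (χ₂ m : ℂ) * F m ∂μG ∂μ :=
        integral_integral_swap hprod₂
    _ = ∫ m : M, (χ₂ m : ℂ) * F m ∂μ := by
        simp_rw [hfib χ₁ χ₂ hχ₁cut]
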